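/- There exist constants c₁, c₂ > 0 such that for every f(q) = ∑_{n≥0} qⁿ aₙ in H²(𝔹) one has c₁·‖f‖²_{H²(𝔹)} ≤ |f(0)|² + (1/π²)·(1/4)·∫_{𝕊} ( ∫_{\{(x,y) ∈ ℝ² : x²+y² < 1\}} |∂_c f(x + yI)|² · (1 − x² − y²) dx dy ) dA_𝕊(I) ≤ c₂·‖f‖²_{H²(𝔹)}. Equivalently, ‖f‖²_{H²(𝔹)} is comparable, with constants independent of f, to |f(0)|² + (1/Vol(𝔹)) ∫_𝔹 |∂_c f(q)|² (1 − |q|²) dVol_𝔹(q). -/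

import Mathlib

open scoped Quaternion ENNReal
open MeasureTheory

/-- The Cullen (slice) derivative of `f(q) = ∑ₙ qⁿ aₙ`, namely
`∂_c f(q) = ∑_{n≥1} n·q^{n−1} aₙ`. -/
noncomputable def cullenDeriv (a : ℕ → ℍ[ℝ]) (q : ℍ[ℝ]) : ℍ[ℝ] :=
  ∑' n : ℕ, ((n + 1 : ℕ) : ℝ) • (q ^ n * a (n + 1))

/-- The identification of `ℝ³` with the imaginary quaternions. -/
def iQ (v : EuclideanSpace ℝ (Fin 3)) : ℍ[ℝ] := ⟨0, v 0, v 1, v 2⟩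

open Set Filter Topology

/-- The point `e^{nθJ} = cos (nθ) + sin (nθ) J` of the slice determined by `J`. -/
noncomputable def sliceExp (J : ℍ[ℝ]) (n : ℕ) (θ : ℝ) : ℍ[ℝ] :=
  ((Real.cos (n * θ) : ℝ) : ℍ[ℝ]) + Real.sin (n * θ) • J

lemma continuous_sliceExp (J : ℍ[ℝ]) (n : ℕ) : Continuous (sliceExp J n) := by
  unfold sliceExp
  have := Quaternion.continuous_coe
  fun_prop

lemma slice_pow {J : ℍ[ℝ]} (hre : J.re = 0)
    (hJ : J.imI ^ 2 + J.imJ ^ 2 + J.imK ^ 2 = 1) (r θ : ℝ) (n : ℕ) :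
    (((r * Real.cos θ : ℝ) : ℍ[ℝ]) + (r * Real.sin θ) • J) ^ n = r ^ n • sliceExp J n θ := by
  induction n with
  | zero => simp [sliceExp]
  | succ n ih =>
    rw [pow_succ, ih]
    have h : ((n + 1 : ℕ) : ℝ) * θ = n * θ + θ := by push_cast; ring
    rw [sliceExp, sliceExp, h, Real.cos_add, Real.sin_add]
    ext
    · simp [hre]
      linear_combination (-r ^ (n + 1) * Real.sin (n * θ) * Real.sin θ) * hJ
    · simp [hre]; ring
    · simp [hre]; ring
    · simp [hre]; ring

lemma inner_sliceExp_mul {J : ℍ[ℝ]} (hre : J.re = 0)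
    (hJ : J.imI ^ 2 + J.imJ ^ 2 + J.imK ^ 2 = 1) (m n : ℕ) (θ : ℝ) (b c : ℍ[ℝ]) :
    inner ℝ (sliceExp J m θ * b) (sliceExp J n θ * c) =
      Real.cos (((m : ℝ) - n) * θ) * inner ℝ b c +
        Real.sin (((m : ℝ) - n) * θ) * inner ℝ (J * b) c := by
  rw [sub_mul, Real.cos_sub, Real.sin_sub]
  simp [Quaternion.inner_def, sliceExp, hre]
  linear_combination (Real.sin (m * θ) * Real.sin (n * θ) *
    (b.re * c.re + b.imI * c.imI + b.imJ * c.imJ + b.imK * c.imK)) * hJ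

lemma norm_sliceExp_mul {J : ℍ[ℝ]} (hre : J.re = 0)
    (hJ : J.imI ^ 2 + J.imJ ^ 2 + J.imK ^ 2 = 1) (n : ℕ) (θ : ℝ) (b : ℍ[ℝ]) :
    ‖sliceExp J n θ * b‖ = ‖b‖ := by
  have h := inner_sliceExp_mul hre hJ n n θ b b
  simp only [sub_self, zero_mul, Real.cos_zero, Real.sin_zero, one_mul, add_zero,
    real_inner_self_eq_norm_sq] at h
  exact (sq_eq_sq₀ (norm_nonneg _) (norm_nonneg _)).1 h

lemma integral_inner_sliceExp {J : ℍ[ℝ]} (hre : J.re = 0)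
    (hJ : J.imI ^ 2 + J.imJ ^ 2 + J.imK ^ 2 = 1) (m n : ℕ) (b c : ℍ[ℝ]) :
    ∫ θ in Ioo (-Real.pi) Real.pi, inner ℝ (sliceExp J m θ * b) (sliceExp J n θ * c) =
      if m = n then 2 * Real.pi * inner ℝ b c else 0 := by
  rw [← integral_Ioc_eq_integral_Ioo,
    ← intervalIntegral.integral_of_le (by linarith [Real.pi_pos])]
  simp_rw [inner_sliceExp_mul hre hJ]
  split_ifs with h
  · subst h
    simp only [sub_self, zero_mul, Real.cos_zero, Real.sin_zero, one_mul, add_zero,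
      intervalIntegral.integral_const, smul_eq_mul]
    ring
  · have hk : (m : ℝ) - n ≠ 0 := sub_ne_zero.2 (by exact_mod_cast h)
    rw [intervalIntegral.integral_add (Continuous.intervalIntegrable (by fun_prop) _ _)
      (Continuous.intervalIntegrable (by fun_prop) _ _), intervalIntegral.integral_mul_const,
      intervalIntegral.integral_mul_const, intervalIntegral.integral_comp_mul_left _ hk,
      intervalIntegral.integral_comp_mul_left _ hk, integral_cos, integral_sin]
    have h1 : Real.sin (((m : ℝ) - n) * Real.pi) = 0 := by
      have := Real.sin_int_mul_pi ((m : ℤ) - n)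
      push_cast at this
      exact this
    simp [h1]

lemma continuous_tsum_sliceExp {J : ℍ[ℝ]} (hre : J.re = 0)
    (hJ : J.imI ^ 2 + J.imJ ^ 2 + J.imK ^ 2 = 1) {b : ℕ → ℍ[ℝ]}
    (hb : Summable fun n => ‖b n‖) : Continuous fun θ => ∑' n, sliceExp J n θ * b n :=
  continuous_tsum (fun n => (continuous_sliceExp J n).mul continuous_const) hb
    fun n θ => (norm_sliceExp_mul hre hJ n θ (b n)).le

lemma norm_tsum_sliceExp_le {J : ℍ[ℝ]} (hre : J.re = 0)
    (hJ : J.imI ^ 2 + J.imJ ^ 2 + J.imK ^ 2 = 1) {b : ℕ → ℍ[ℝ]}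
    (hb : Summable fun n => ‖b n‖) (θ : ℝ) :
    ‖∑' n, sliceExp J n θ * b n‖ ≤ ∑' n, ‖b n‖ :=
  tsum_of_norm_bounded hb.hasSum fun n => (norm_sliceExp_mul hre hJ n θ (b n)).le

lemma hasSum_integral_inner_sliceExp {J : ℍ[ℝ]} (hre : J.re = 0)
    (hJ : J.imI ^ 2 + J.imJ ^ 2 + J.imK ^ 2 = 1) {b : ℕ → ℍ[ℝ]}
    (hb : Summable fun n => ‖b n‖) {w : ℝ → ℍ[ℝ]} (hw : Continuous w) {C : ℝ}
    (hC : ∀ θ, ‖w θ‖ ≤ C) :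
    HasSum (fun n => ∫ θ in Ioo (-Real.pi) Real.pi, inner ℝ (w θ) (sliceExp J n θ * b n))
      (∫ θ in Ioo (-Real.pi) Real.pi, inner ℝ (w θ) (∑' n, sliceExp J n θ * b n)) := by
  have hbound : ∀ n θ, ‖inner ℝ (w θ) (sliceExp J n θ * b n)‖ ≤ C * ‖b n‖ := fun n θ => by
    refine (norm_inner_le_norm _ _).trans ?_
    rw [norm_sliceExp_mul hre hJ]
    exact mul_le_mul_of_nonneg_right (hC θ) (norm_nonneg _)
  have hcont : ∀ n, Continuous fun θ => inner ℝ (w θ) (sliceExp J n θ * b n) := fun n =>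
    hw.inner ((continuous_sliceExp J n).mul continuous_const)
  have hint : ∀ n, Integrable (fun θ => inner ℝ (w θ) (sliceExp J n θ * b n))
      (volume.restrict (Ioo (-Real.pi) Real.pi)) := fun n =>
    Integrable.of_bound (hcont n).aestronglyMeasurable (C * ‖b n‖)
      (ae_of_all _ (hbound n))
  have key := hasSum_integral_of_summable_integral_norm hint (by
    refine Summable.of_nonneg_of_le (fun n => integral_nonneg fun θ => norm_nonneg _)
      (fun n => ?_) (hb.mul_left (2 * Real.pi * C))
    refine (integral_mono (hint n).norm (integrable_const (C * ‖b n‖)) (hbound n)).trans ?_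
    have : (0 : ℝ) ≤ Real.pi + Real.pi := by linarith [Real.pi_pos]
    simp [this]
    apply le_of_eq
    ring)
  have hs : ∀ θ, Summable fun n => sliceExp J n θ * b n := fun θ =>
    Summable.of_norm (by simpa only [norm_sliceExp_mul hre hJ] using hb)
  have hinner : ∀ θ, inner ℝ (w θ) (∑' n, sliceExp J n θ * b n) =
      ∑' n, inner ℝ (w θ) (sliceExp J n θ * b n) := fun θ =>
    (innerSL ℝ (w θ)).map_tsum (hs θ)
  simp_rw [hinner]
  exact key

lemma hasSum_parseval_sliceExp {J : ℍ[ℝ]} (hre : J.re = 0)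
    (hJ : J.imI ^ 2 + J.imJ ^ 2 + J.imK ^ 2 = 1) {b : ℕ → ℍ[ℝ]}
    (hb : Summable fun n => ‖b n‖) :
    HasSum (fun n => 2 * Real.pi * ‖b n‖ ^ 2)
      (∫ θ in Ioo (-Real.pi) Real.pi, ‖∑' n, sliceExp J n θ * b n‖ ^ 2) := by
  have h := hasSum_integral_inner_sliceExp hre hJ hb (continuous_tsum_sliceExp hre hJ hb)
    (norm_tsum_sliceExp_le hre hJ hb)
  simp_rw [real_inner_self_eq_norm_sq] at h
  convert h using 2 with n
  simp_rw [real_inner_comm (sliceExp J n _ * b n)]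
  have h2 := hasSum_integral_inner_sliceExp hre hJ hb (w := fun θ => sliceExp J n θ * b n)
    ((continuous_sliceExp J n).mul continuous_const)
    (fun θ => (norm_sliceExp_mul hre hJ n θ (b n)).le)
  simp_rw [integral_inner_sliceExp hre hJ] at h2
  refine (h2.unique ?_).symm
  convert hasSum_ite_eq n (2 * Real.pi * ‖b n‖ ^ 2) using 2 with m
  by_cases hmn : m = n
  · subst hmn; simp
  · simp [hmn, Ne.symm hmn]

lemma lintegral_parseval_sliceExp {J : ℍ[ℝ]} (hre : J.re = 0)
    (hJ : J.imI ^ 2 + J.imJ ^ 2 + J.imK ^ 2 = 1) {b : ℕ → ℍ[ℝ]}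
    (hb : Summable fun n => ‖b n‖) :
    ∫⁻ θ in Ioo (-Real.pi) Real.pi, ENNReal.ofReal (‖∑' n, sliceExp J n θ * b n‖ ^ 2) =
      ∑' n, ENNReal.ofReal (2 * Real.pi * ‖b n‖ ^ 2) := by
  have h := hasSum_parseval_sliceExp hre hJ hb
  have hpi := Real.pi_pos
  rw [← ENNReal.ofReal_tsum_of_nonneg (fun n => by positivity) h.summable, h.tsum_eq,
    ofReal_integral_eq_lintegral_ofReal _ (ae_of_all _ fun θ => by positivity)]
  refine Integrable.of_bound
    ((continuous_tsum_sliceExp hre hJ hb).norm.pow 2).aestronglyMeasurable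
    ((∑' n, ‖b n‖) ^ 2) (ae_of_all _ fun θ => ?_)
  rw [norm_pow, norm_norm]
  exact pow_le_pow_left₀ (norm_nonneg _) (norm_tsum_sliceExp_le hre hJ hb θ) 2

lemma summable_cullen_coeff {a : ℕ → ℍ[ℝ]} (ha : Summable fun n => ‖a n‖ ^ 2) {r : ℝ}
    (hr : |r| < 1) : Summable fun n : ℕ => ((n + 1 : ℕ) : ℝ) * |r| ^ n * ‖a (n + 1)‖ := by
  obtain ⟨C, hC⟩ := ha.tendsto_atTop_zero.bddAbove_range
  have hC' : ∀ n, ‖a n‖ ≤ C + 1 := fun n => by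
    have := hC (mem_range_self n)
    nlinarith [sq_nonneg (‖a n‖ - 1)]
  have hr' : ‖|r|‖ < 1 := by simpa using hr
  have hs : Summable fun n : ℕ => (((n + 1 : ℕ) : ℝ) * |r| ^ n) := by
    have h1 := summable_pow_mul_geometric_of_norm_lt_one 1 hr'
    have h0 := summable_geometric_of_norm_lt_one hr'
    refine (h1.add h0).congr fun n => ?_
    push_cast; ring
  refine Summable.of_nonneg_of_le (fun n => by positivity) (fun n => ?_) (hs.mul_right (C + 1))
  exact mul_le_mul_of_nonneg_left (hC' _) (by positivity)

lemma lintegral_radial_weight (n : ℕ) :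
    ∫⁻ r in Ioo (0 : ℝ) 1, ENNReal.ofReal (r ^ (2 * n + 1) - r ^ (2 * n + 3)) =
      ENNReal.ofReal (1 / (2 * (n + 1) * (n + 2))) := by
  have hc : Continuous fun r : ℝ => r ^ (2 * n + 1) - r ^ (2 * n + 3) := by fun_prop
  rw [← ofReal_integral_eq_lintegral_ofReal]
  · rw [← integral_Ioc_eq_integral_Ioo, ← intervalIntegral.integral_of_le zero_le_one,
      intervalIntegral.integral_sub (Continuous.intervalIntegrable (by fun_prop) _ _)
      (Continuous.intervalIntegrable (by fun_prop) _ _), integral_pow, integral_pow]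
    congr 1
    have h1 : (n : ℝ) + 1 ≠ 0 := by positivity
    have h2 : (n : ℝ) + 2 ≠ 0 := by positivity
    have h3 : (2 * n + 1 + 1 : ℝ) ≠ 0 := by positivity
    have h4 : (2 * n + 3 + 1 : ℝ) ≠ 0 := by positivity
    push_cast
    simp
    field_simp
    ring
  · exact (hc.integrableOn_Icc (a := 0) (b := 1)).mono_set Ioo_subset_Icc_self
  · filter_upwards [ae_restrict_mem measurableSet_Ioo] with r hr
    exact sub_nonneg.2 (pow_le_pow_of_le_one hr.1.le hr.2.le (by omega))

lemma norm_sq_slice {J : ℍ[ℝ]} (hre : J.re = 0)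
    (hJ : J.imI ^ 2 + J.imJ ^ 2 + J.imK ^ 2 = 1) (x y : ℝ) :
    ‖(x : ℍ[ℝ]) + y • J‖ ^ 2 = x ^ 2 + y ^ 2 := by
  rw [← real_inner_self_eq_norm_sq, Quaternion.inner_self, Quaternion.normSq_def']
  simp [hre]
  linear_combination y ^ 2 * hJ

lemma summable_cullenDeriv {a : ℕ → ℍ[ℝ]} (ha : Summable fun n => ‖a n‖ ^ 2) {q : ℍ[ℝ]}
    (hq : ‖q‖ < 1) : Summable fun n : ℕ => ((n + 1 : ℕ) : ℝ) • (q ^ n * a (n + 1)) := by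
  refine Summable.of_norm ((summable_cullen_coeff ha (r := ‖q‖) (by simpa using hq)).congr
    fun n => ?_)
  rw [norm_smul, norm_mul, norm_pow, abs_norm, mul_assoc, Real.norm_natCast]

/-- The integrand of the slice integral, extended by zero off the unit disc. -/
noncomputable def sliceDensity (a : ℕ → ℍ[ℝ]) (J : ℍ[ℝ]) : ℝ × ℝ → ℝ :=
  {p : ℝ × ℝ | p.1 ^ 2 + p.2 ^ 2 < 1}.indicator fun p =>
    ‖cullenDeriv a ((p.1 : ℍ[ℝ]) + p.2 • J)‖ ^ 2 * (1 - p.1 ^ 2 - p.2 ^ 2)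

lemma measurableSet_unitDisc : MeasurableSet {p : ℝ × ℝ | p.1 ^ 2 + p.2 ^ 2 < 1} :=
  (isOpen_lt (by fun_prop) continuous_const).measurableSet

lemma measurable_sliceDensity {a : ℕ → ℍ[ℝ]} (ha : Summable fun n => ‖a n‖ ^ 2) {J : ℍ[ℝ]}
    (hre : J.re = 0) (hJ : J.imI ^ 2 + J.imJ ^ 2 + J.imK ^ 2 = 1) :
    Measurable (sliceDensity a J) := by
  let F : ℕ → ℝ × ℝ → ℝ := fun N => {p : ℝ × ℝ | p.1 ^ 2 + p.2 ^ 2 < 1}.indicator fun p =>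
    ‖∑ n ∈ Finset.range N, ((n + 1 : ℕ) : ℝ) • (((p.1 : ℍ[ℝ]) + p.2 • J) ^ n * a (n + 1))‖ ^ 2 *
      (1 - p.1 ^ 2 - p.2 ^ 2)
  refine measurable_of_tendsto_metrizable (f := F) (fun N => ?_) (tendsto_pi_nhds.2 fun p => ?_)
  · refine Measurable.indicator (Continuous.measurable ?_) measurableSet_unitDisc
    have hq : Continuous fun p : ℝ × ℝ => (p.1 : ℍ[ℝ]) + p.2 • J :=
      (Quaternion.continuous_coe.comp continuous_fst).add (continuous_snd.smul continuous_const)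
    fun_prop
  · by_cases hp : p ∈ {p : ℝ × ℝ | p.1 ^ 2 + p.2 ^ 2 < 1}
    · simp only [F, sliceDensity, indicator_of_mem hp]
      have hq : ‖(p.1 : ℍ[ℝ]) + p.2 • J‖ < 1 := by
        have h := norm_sq_slice hre hJ p.1 p.2
        have hp' : p.1 ^ 2 + p.2 ^ 2 < 1 := hp
        nlinarith [norm_nonneg ((p.1 : ℍ[ℝ]) + p.2 • J)]
      exact (((summable_cullenDeriv ha hq).hasSum.tendsto_sum_nat).norm.pow 2).mul_const _
    · simp [F, sliceDensity, indicator_of_notMem hp]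

lemma cullenDeriv_polar {J : ℍ[ℝ]} (hre : J.re = 0)
    (hJ : J.imI ^ 2 + J.imJ ^ 2 + J.imK ^ 2 = 1) (a : ℕ → ℍ[ℝ]) (r θ : ℝ) :
    cullenDeriv a (((r * Real.cos θ : ℝ) : ℍ[ℝ]) + (r * Real.sin θ) • J) =
      ∑' n : ℕ, sliceExp J n θ * ((((n + 1 : ℕ) : ℝ) * r ^ n) • a (n + 1)) := by
  unfold cullenDeriv
  refine tsum_congr fun n => ?_
  rw [slice_pow hre hJ, smul_mul_assoc, mul_smul_comm, smul_smul]

lemma lintegral_circle_sliceDensity {a : ℕ → ℍ[ℝ]} (ha : Summable fun n => ‖a n‖ ^ 2) {J : ℍ[ℝ]}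
    (hre : J.re = 0) (hJ : J.imI ^ 2 + J.imJ ^ 2 + J.imK ^ 2 = 1) {r : ℝ}
    (hr : r ∈ Ioo (0 : ℝ) 1) :
    ∫⁻ θ in Ioo (-Real.pi) Real.pi, ENNReal.ofReal r *
        ENNReal.ofReal (sliceDensity a J (r * Real.cos θ, r * Real.sin θ)) =
      ∑' n : ℕ, ENNReal.ofReal (2 * Real.pi * ((n + 1 : ℕ) : ℝ) ^ 2 * ‖a (n + 1)‖ ^ 2) *
        ENNReal.ofReal (r ^ (2 * n + 1) - r ^ (2 * n + 3)) := by
  have hr2 : r ^ 2 < 1 := by nlinarith [hr.1, hr.2]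
  have hw : 0 ≤ r * (1 - r ^ 2) := mul_nonneg hr.1.le (by linarith)
  have hb : Summable fun n : ℕ => ‖(((n + 1 : ℕ) : ℝ) * r ^ n) • a (n + 1)‖ := by
    refine (summable_cullen_coeff ha (r := r) (by rw [abs_of_pos hr.1]; exact hr.2)).congr
      fun n => ?_
    rw [norm_smul, norm_mul, norm_pow, Real.norm_eq_abs r, Real.norm_natCast]
  have hpt : ∀ θ : ℝ, ENNReal.ofReal r *
      ENNReal.ofReal (sliceDensity a J (r * Real.cos θ, r * Real.sin θ)) =
      ENNReal.ofReal (r * (1 - r ^ 2)) * ENNReal.ofReal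
        (‖∑' n : ℕ, sliceExp J n θ * ((((n + 1 : ℕ) : ℝ) * r ^ n) • a (n + 1))‖ ^ 2) := fun θ => by
    have h1 : (r * Real.cos θ) ^ 2 + (r * Real.sin θ) ^ 2 = r ^ 2 := by
      linear_combination r ^ 2 * Real.cos_sq_add_sin_sq θ
    have hmem : (r * Real.cos θ, r * Real.sin θ) ∈ {p : ℝ × ℝ | p.1 ^ 2 + p.2 ^ 2 < 1} := by
      simpa [h1] using hr2
    rw [sliceDensity, indicator_of_mem hmem, cullenDeriv_polar hre hJ, ← ENNReal.ofReal_mul hr.1.le,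
      ← ENNReal.ofReal_mul hw]
    congr 1
    rw [sub_sub, h1]
    ring
  simp_rw [hpt]
  rw [lintegral_const_mul' _ _ ENNReal.ofReal_ne_top, lintegral_parseval_sliceExp hre hJ hb,
    ← ENNReal.tsum_mul_left]
  refine tsum_congr fun n => ?_
  have hpi := Real.pi_pos
  rw [← ENNReal.ofReal_mul hw, ← ENNReal.ofReal_mul (by positivity), norm_smul, norm_mul, norm_pow,
    Real.norm_eq_abs r, abs_of_pos hr.1, Real.norm_natCast]
  congr 1
  ring

lemma lintegral_sliceDensity {a : ℕ → ℍ[ℝ]} (ha : Summable fun n => ‖a n‖ ^ 2) {J : ℍ[ℝ]}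
    (hre : J.re = 0) (hJ : J.imI ^ 2 + J.imJ ^ 2 + J.imK ^ 2 = 1) :
    ∫⁻ p, ENNReal.ofReal (sliceDensity a J p) =
      ∑' n : ℕ, ENNReal.ofReal (Real.pi * (((n : ℝ) + 1) / (n + 2) * ‖a (n + 1)‖ ^ 2)) := by
  have hmeas : Measurable fun p : ℝ × ℝ => ENNReal.ofReal p.1 *
      ENNReal.ofReal (sliceDensity a J (p.1 * Real.cos p.2, p.1 * Real.sin p.2)) :=
    measurable_fst.ennreal_ofReal.mul
      ((measurable_sliceDensity ha hre hJ).comp (by fun_prop)).ennreal_ofReal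
  rw [← lintegral_comp_polarCoord_symm]
  simp only [polarCoord_target, polarCoord_symm_apply, smul_eq_mul]
  rw [Measure.volume_eq_prod, ← Measure.prod_restrict, lintegral_prod _ hmeas.aemeasurable]
  have hsplit : ∫⁻ r in Ioi (0 : ℝ), ∫⁻ θ in Ioo (-Real.pi) Real.pi, ENNReal.ofReal r *
        ENNReal.ofReal (sliceDensity a J (r * Real.cos θ, r * Real.sin θ)) =
      ∫⁻ r in Ioo (0 : ℝ) 1, ∫⁻ θ in Ioo (-Real.pi) Real.pi, ENNReal.ofReal r *
        ENNReal.ofReal (sliceDensity a J (r * Real.cos θ, r * Real.sin θ)) := by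
    rw [← lintegral_indicator measurableSet_Ioi, ← lintegral_indicator measurableSet_Ioo]
    refine lintegral_congr fun r => ?_
    by_cases hr : r ∈ Ioo (0 : ℝ) 1
    · rw [indicator_of_mem hr, indicator_of_mem (Ioo_subset_Ioi_self hr)]
    rw [indicator_of_notMem hr]
    refine indicator_apply_eq_zero.2 fun hr0 => ?_
    have hr1 : 1 ≤ r := by
      by_contra h
      exact hr ⟨hr0, not_le.1 h⟩
    have hz : ∀ θ, sliceDensity a J (r * Real.cos θ, r * Real.sin θ) = 0 := fun θ => by
      refine indicator_of_notMem (fun hmem => ?_) _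
      have h1 : (r * Real.cos θ) ^ 2 + (r * Real.sin θ) ^ 2 < 1 := hmem
      have h2 : (r * Real.cos θ) ^ 2 + (r * Real.sin θ) ^ 2 = r ^ 2 := by
        linear_combination r ^ 2 * Real.cos_sq_add_sin_sq θ
      nlinarith
    simp [hz]
  rw [hsplit, setLIntegral_congr_fun measurableSet_Ioo
    fun r hr => lintegral_circle_sliceDensity ha hre hJ hr,
    lintegral_tsum fun n => by fun_prop]
  refine tsum_congr fun n => ?_
  have hpi := Real.pi_pos
  rw [lintegral_const_mul' _ _ ENNReal.ofReal_ne_top, lintegral_radial_weight,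
    ← ENNReal.ofReal_mul (by positivity)]
  congr 1
  push_cast
  field_simp

lemma summable_weighted_coeff {a : ℕ → ℍ[ℝ]} (ha : Summable fun n => ‖a n‖ ^ 2) :
    Summable fun n : ℕ => ((n : ℝ) + 1) / (n + 2) * ‖a (n + 1)‖ ^ 2 := by
  refine Summable.of_nonneg_of_le (fun n => by positivity) (fun n => ?_)
    ((summable_nat_add_iff 1).2 ha)
  refine mul_le_of_le_one_left (by positivity) ?_
  rw [div_le_one (by positivity)]
  linarith

lemma integral_slice {a : ℕ → ℍ[ℝ]} (ha : Summable fun n => ‖a n‖ ^ 2) {J : ℍ[ℝ]}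
    (hre : J.re = 0) (hJ : J.imI ^ 2 + J.imJ ^ 2 + J.imK ^ 2 = 1) :
    ∫ p in {p : ℝ × ℝ | p.1 ^ 2 + p.2 ^ 2 < 1},
        ‖cullenDeriv a ((p.1 : ℍ[ℝ]) + p.2 • J)‖ ^ 2 * (1 - p.1 ^ 2 - p.2 ^ 2) =
      Real.pi * ∑' n : ℕ, ((n : ℝ) + 1) / (n + 2) * ‖a (n + 1)‖ ^ 2 := by
  have hpi := Real.pi_pos
  have hnonneg : ∀ p, 0 ≤ sliceDensity a J p := fun p => by
    refine indicator_nonneg (fun p hp => mul_nonneg (by positivity) ?_) p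
    have hp' : p.1 ^ 2 + p.2 ^ 2 < 1 := hp
    linarith
  rw [← integral_indicator measurableSet_unitDisc]
  change ∫ p, sliceDensity a J p = _
  rw [integral_eq_lintegral_of_nonneg_ae (ae_of_all _ hnonneg)
    (measurable_sliceDensity ha hre hJ).aestronglyMeasurable, lintegral_sliceDensity ha hre hJ,
    ← ENNReal.ofReal_tsum_of_nonneg (fun n => by positivity)
      ((summable_weighted_coeff ha).mul_left _),
    ENNReal.toReal_ofReal (tsum_nonneg fun n => by positivity), tsum_mul_left]

lemma iQ_sphere (I : Metric.sphere (0 : EuclideanSpace ℝ (Fin 3)) 1) :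
    (iQ I).imI ^ 2 + (iQ I).imJ ^ 2 + (iQ I).imK ^ 2 = 1 := by
  have h : ‖(I : EuclideanSpace ℝ (Fin 3))‖ ^ 2 = 1 := by simp
  rw [EuclideanSpace.real_norm_sq_eq, Fin.sum_univ_three] at h
  exact h

lemma toSphere_real_univ_fin_three :
    ((volume : Measure (EuclideanSpace ℝ (Fin 3))).toSphere).real univ = 4 * Real.pi := by
  rw [Measure.toSphere_real_apply_univ, measureReal_def, EuclideanSpace.volume_ball_fin_three]
  have : 0 ≤ Real.pi * 4 / 3 := by positivity
  simp [this]
  ring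

/-- **Equivalent weighted norm on `H²(𝔹)`.**
There are constants `c₁, c₂ > 0` such that for every `f(q) = ∑ₙ qⁿ aₙ` in `H²(𝔹)`,
`‖f‖²_{H²(𝔹)}` is comparable to
`|f(0)|² + (1/Vol(𝔹)) ∫_𝔹 |∂_c f(q)|² (1 − |q|²) dVol_𝔹(q)`, where
`dVol_𝔹(x+yI) = (1/4) dA_𝕊(I) dx dy` in slice coordinates (`dA_𝕊` the surface area
measure on the 2-sphere of imaginary units, total area `4π`), and `Vol(𝔹) = π²`. -/
theorem hardy_norm_comparable_weighted_integral :
    ∃ c₁ c₂ : ℝ, 0 < c₁ ∧ 0 < c₂ ∧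
      ∀ a : ℕ → ℍ[ℝ], Summable (fun n => ‖a n‖ ^ 2) →
        c₁ * ∑' n : ℕ, ‖a n‖ ^ 2
          ≤ ‖a 0‖ ^ 2 + (1 / Real.pi ^ 2) * ((1 / 4) *
              ∫ I : Metric.sphere (0 : EuclideanSpace ℝ (Fin 3)) 1,
                (∫ p in {p : ℝ × ℝ | p.1 ^ 2 + p.2 ^ 2 < 1},
                  ‖cullenDeriv a ((p.1 : ℍ[ℝ]) + p.2 • iQ (I : EuclideanSpace ℝ (Fin 3)))‖ ^ 2 *
                    (1 - p.1 ^ 2 - p.2 ^ 2) ∂(volume : Measure (ℝ × ℝ)))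
                ∂((volume : Measure (EuclideanSpace ℝ (Fin 3))).toSphere)) ∧
        ‖a 0‖ ^ 2 + (1 / Real.pi ^ 2) * ((1 / 4) *
              ∫ I : Metric.sphere (0 : EuclideanSpace ℝ (Fin 3)) 1,
                (∫ p in {p : ℝ × ℝ | p.1 ^ 2 + p.2 ^ 2 < 1},
                  ‖cullenDeriv a ((p.1 : ℍ[ℝ]) + p.2 • iQ (I : EuclideanSpace ℝ (Fin 3)))‖ ^ 2 *
                    (1 - p.1 ^ 2 - p.2 ^ 2) ∂(volume : Measure (ℝ × ℝ)))
                ∂((volume : Measure (EuclideanSpace ℝ (Fin 3))).toSphere))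
          ≤ c₂ * ∑' n : ℕ, ‖a n‖ ^ 2 := by
  refine ⟨1 / 2, 1, by norm_num, one_pos, fun a ha => ?_⟩
  have hpi := Real.pi_pos
  simp_rw [fun I : Metric.sphere (0 : EuclideanSpace ℝ (Fin 3)) 1 =>
    integral_slice ha (J := iQ I) rfl (iQ_sphere I)]
  rw [integral_const, toSphere_real_univ_fin_three, smul_eq_mul]
  have hs := (summable_nat_add_iff 1).2 ha
  have hw := summable_weighted_coeff ha
  have hsimp : ∀ S : ℝ, 1 / Real.pi ^ 2 * (1 / 4 * (4 * Real.pi * (Real.pi * S))) = S :=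
    fun S => by field_simp
  rw [hsimp, ha.tsum_eq_zero_add]
  have hlow : 1 / 2 * ∑' n : ℕ, ‖a (n + 1)‖ ^ 2 ≤
      ∑' n : ℕ, ((n : ℝ) + 1) / (n + 2) * ‖a (n + 1)‖ ^ 2 := by
    rw [← tsum_mul_left]
    refine (hs.mul_left _).tsum_le_tsum (fun n => ?_) hw
    refine mul_le_mul_of_nonneg_right ?_ (by positivity)
    rw [div_le_div_iff₀ (by norm_num) (by positivity)]
    linarith [(Nat.cast_nonneg n : (0 : ℝ) ≤ n)]
  have hup : ∑' n : ℕ, ((n : ℝ) + 1) / (n + 2) * ‖a (n + 1)‖ ^ 2 ≤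
      ∑' n : ℕ, ‖a (n + 1)‖ ^ 2 := by
    refine hw.tsum_le_tsum (fun n => mul_le_of_le_one_left (by positivity) ?_) hs
    rw [div_le_one (by positivity)]
    linarith
  constructor
  · linarith [sq_nonneg ‖a 0‖]
  · linarith
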